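/- Let G be a group with G_ab ≅ ℤ and let a ∈ G be an element such that (i) G is the normal closure of a, (ii) the class of a generates G_ab, and such that ζ : C_G(a) → H₂G, g ↦ cls([a|g] − [g|a]), is surjective. Then the restriction of ζ to C_G(a) ∩ [G,G] is still surjective onto H₂G: every class in H₂G is of the form cls([a|g] − [g|a]) for some g in C_G(a) ∩ [G,G]. -/

import Mathlib

open Finsupp

noncomputable section

universe u

/-- Degree-2 differential of the (unnormalized) inhomogeneous bar complex of `G`
with trivial `ℤ` coefficients: `[g|h] ↦ [h] - [gh] + [g]`. -/
def d2 (G : Type*) [Group G] : ((G × G) →₀ ℤ) →ₗ[ℤ] (G →₀ ℤ) :=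
  Finsupp.lift _ ℤ _ fun p => single p.2 1 - single (p.1 * p.2) 1 + single p.1 1

/-- Degree-3 differential: `[g|h|k] ↦ [h|k] - [gh|k] + [g|hk] - [g|h]`. -/
def d3 (G : Type*) [Group G] : ((G × G × G) →₀ ℤ) →ₗ[ℤ] ((G × G) →₀ ℤ) :=
  Finsupp.lift _ ℤ _ fun t =>
    single (t.2.1, t.2.2) 1 - single (t.1 * t.2.1, t.2.2) 1 +
      single (t.1, t.2.1 * t.2.2) 1 - single (t.1, t.2.1) 1

/-- 2-cycles. -/
def Z2 (G : Type*) [Group G] : Submodule ℤ ((G × G) →₀ ℤ) := LinearMap.ker (d2 G)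

/-- 2-boundaries, as a submodule of the 2-cycles. -/
def B2 (G : Type*) [Group G] : Submodule ℤ (Z2 G) :=
  (LinearMap.range (d3 G)).comap (Z2 G).subtype

/-- The second integral homology of `G`, defined via the inhomogeneous bar complex. -/
abbrev H2 (G : Type*) [Group G] := Z2 G ⧸ B2 G

/-- The homology class of a 2-cycle. -/
def H2cls (G : Type*) [Group G] (z : (G × G) →₀ ℤ) (hz : z ∈ Z2 G) : H2 G :=
  Submodule.Quotient.mk ⟨z, hz⟩

/-- The bar 2-chain `[a|g] - [g|a]`. -/
def barChain (G : Type*) [Group G] (a g : G) : (G × G) →₀ ℤ :=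
  single (a, g) 1 - single (g, a) 1

theorem barChain_mem (G : Type*) [Group G] (a g : G) (h : a * g = g * a) :
    barChain G a g ∈ Z2 G := by
  simp only [Z2, LinearMap.mem_ker, barChain, map_sub, d2, Finsupp.lift_apply]
  rw [sum_single_index, sum_single_index] <;>
    simp [h, sub_add_eq_sub_sub]
  abel

/-- The homology class of the 2-cycle `[a|g] - [g|a]` (defined to be `0` if `a` and `g`
do not commute). -/
def barCls (G : Type*) [Group G] (a g : G) : H2 G :=
  open scoped Classical in
  if h : a * g = g * a then H2cls G (barChain G a g) (barChain_mem G a g h) else 0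

theorem barCls_of_commute (G : Type*) [Group G] {a g : G} (h : a * g = g * a) :
    barCls G a g = H2cls G (barChain G a g) (barChain_mem G a g h) :=
  dif_pos h

theorem d3_single (G : Type*) [Group G] (g h k : G) :
    d3 G (single (g, h, k) 1) =
      single (h, k) 1 - single (g * h, k) 1 + single (g, h * k) 1 - single (g, h) 1 := by
  simp [d3, Finsupp.lift_apply]

theorem barCls_mul (G : Type*) [Group G] {a g h : G} (hg : a * g = g * a) (hh : a * h = h * a) :
    barCls G a (g * h) = barCls G a g + barCls G a h := by
  have hgh : a * (g * h) = g * h * a := by rw [← mul_assoc, hg, mul_assoc, hh, mul_assoc]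
  rw [barCls_of_commute G hgh, barCls_of_commute G hg, barCls_of_commute G hh]
  unfold H2cls
  rw [← Submodule.Quotient.mk_add, Submodule.Quotient.eq]
  refine ⟨single (a, g, h) 1 + single (g, h, a) 1 - single (g, a, h) 1, ?_⟩
  simp only [map_add, map_sub, d3_single, Submodule.subtype_apply, barChain,
    hg, hh]
  abel

theorem barCls_self (G : Type*) [Group G] (a : G) : barCls G a a = 0 := by
  rw [barCls_of_commute G rfl, H2cls, Submodule.Quotient.mk_eq_zero]
  simp [B2, barChain]

/-- The homomorphism `C_G(a) → H₂G`, `g ↦ [a|g] - [g|a]`. -/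
def zetaHom (G : Type*) [Group G] (a : G) :
    Subgroup.centralizer {a} →* Multiplicative (H2 G) :=
  MonoidHom.mk' (fun g => Multiplicative.ofAdd (barCls G a g)) fun g h =>
    congrArg Multiplicative.ofAdd <|
      barCls_mul G (Subgroup.mem_centralizer_singleton_iff.mp g.2).symm
        (Subgroup.mem_centralizer_singleton_iff.mp h.2).symm

theorem barCls_mul_zpow (G : Type*) [Group G] {a g : G} (hg : g ∈ Subgroup.centralizer {a})
    (n : ℤ) : barCls G a (g * a ^ n) = barCls G a g := by
  let a' : Subgroup.centralizer {a} := ⟨a, Subgroup.mem_centralizer_singleton_iff.mpr rfl⟩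
  have ha : zetaHom G a a' = 1 := congrArg Multiplicative.ofAdd (barCls_self G a)
  have key : zetaHom G a (⟨g, hg⟩ * a' ^ n) = zetaHom G a ⟨g, hg⟩ := by
    rw [map_mul, map_zpow, ha, one_zpow, mul_one]
  exact congrArg Multiplicative.toAdd key

/-- If the abelianization of `G` is infinite cyclic, `a ∈ G` is such that (i) `G` is the
normal closure of `a`, (ii) the class of `a` generates the abelianization, and the
homomorphism `ζ : C_G(a) → H₂G, g ↦ [a|g] - [g|a]` is surjective, then the restriction of
`ζ` to `C_G(a) ∩ [G,G]` is still surjective onto `H₂G`. -/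
theorem zeta_restricted_surjective_irreducible (G : Type u) [Group G]
    (hab : Nonempty (Additive (Abelianization G) ≃+ ℤ)) (a : G)
    (h1 : Subgroup.normalClosure {a} = ⊤)
    (h2 : Subgroup.zpowers (Abelianization.of a) = ⊤)
    (hsurj : ∀ h : H2 G, ∃ g ∈ Subgroup.centralizer {a}, h = barCls G a g) :
    ∀ h : H2 G, ∃ g : G,
      g ∈ Subgroup.centralizer {a} ∧ g ∈ commutator G ∧ h = barCls G a g := by
  intro h
  obtain ⟨g, hg, rfl⟩ := hsurj h
  obtain ⟨n, hn⟩ : Abelianization.of g ∈ Subgroup.zpowers (Abelianization.of a) :=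
    h2 ▸ Subgroup.mem_top _
  have ha : a ∈ Subgroup.centralizer {a} := Subgroup.mem_centralizer_singleton_iff.mpr rfl
  refine ⟨g * a ^ (-n), mul_mem hg (zpow_mem ha _), ?_, (barCls_mul_zpow G hg _).symm⟩
  rw [← Abelianization.ker_of, MonoidHom.mem_ker, map_mul, map_zpow, ← hn, zpow_neg]
  exact mul_inv_cancel _

end
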